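/- If Φ₁, Φ₂ ∈ 𝔉H, then the Schur idempotent Φ₁∨Φ₂ = Φ₁ + Φ₂ − Φ₁∘Φ₂ (whose range is ran Φ₁ + ran Φ₂) belongs to 𝔉H, and λ(Φ₁∨Φ₂) ≤ λ(Φ₁)·λ(Φ₂). In particular, the set 𝔉H is a sublattice of the lattice of all Schur idempotents under Φ∧Ψ = ΦΨ and Φ∨Ψ = Φ+Ψ−ΦΨ. -/

import Mathlib

open scoped InnerProductSpace Pointwise

noncomputable section

namespace SchurHyper

/-- `B H` is the algebra of bounded linear operators on `H`. -/
abbrev B (H : Type*) [NormedAddCommGroup H] [InnerProductSpace ℂ H] : Type _ := H →L[ℂ] H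

variable (H : Type*) [NormedAddCommGroup H] [InnerProductSpace ℂ H]

/-- A linear functional on `B H` is *normal* (weak* continuous) if it arises from
the duality with the trace class, i.e. it is of the form
`T ↦ ∑ₙ ⟪yₙ, T xₙ⟫` for square-summable sequences `(xₙ)`, `(yₙ)`
(recall that the inner product is conjugate-linear in its first slot). -/
def IsNormalFunctional (ω : B H →ₗ[ℂ] ℂ) : Prop :=
  ∃ x y : ℕ → H, Summable (fun n => ‖x n‖ ^ 2) ∧ Summable (fun n => ‖y n‖ ^ 2) ∧
    ∀ T : B H, ω T = ∑' n, ⟪y n, T (x n)⟫_ℂ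

/-- The weak* topology on `B H`: the topology induced by the normal functionals. -/
def weakStarTopology : TopologicalSpace (B H) :=
  TopologicalSpace.induced
    (fun (T : B H) (ω : {ω : B H →ₗ[ℂ] ℂ // IsNormalFunctional H ω}) => ω.1 T)
    inferInstance

/-- A set of operators is weak* closed if it is closed in the weak* topology. -/
def WStarClosed (X : Set (B H)) : Prop := @IsClosed _ (weakStarTopology H) X

/-- The weak* closure of a set of operators. -/
def wStarClosure (X : Set (B H)) : Set (B H) := @closure _ (weakStarTopology H) X

/-- A map on `B H` is weak* continuous if it is continuous with respect to the
weak* topology on both sides. -/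
def WStarContinuous (Φ : B H →L[ℂ] B H) : Prop :=
  @Continuous _ _ (weakStarTopology H) (weakStarTopology H) Φ

variable {H}
variable [CompleteSpace H]

/-- A maximal abelian selfadjoint subalgebra of `B H`: an abelian selfadjoint
subalgebra which contains every operator commuting with it (equivalently, it
coincides with its own commutant). -/
def IsMasa (D : StarSubalgebra ℂ (B H)) : Prop :=
  (∀ A ∈ D, ∀ C ∈ D, A * C = C * A) ∧
  (∀ T : B H, (∀ A ∈ D, T * A = A * T) → T ∈ D)

/-- A Schur multiplier: a weak* continuous `D`-bimodule map on `B H`. -/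
def IsSchurMultiplier (D : StarSubalgebra ℂ (B H)) (Φ : B H →L[ℂ] B H) : Prop :=
  WStarContinuous H Φ ∧ ∀ A ∈ D, ∀ C ∈ D, ∀ T : B H, Φ (A * T * C) = A * Φ T * C

/-- A Schur idempotent: an idempotent Schur multiplier. -/
def IsSchurIdempotent (D : StarSubalgebra ℂ (B H)) (Φ : B H →L[ℂ] B H) : Prop :=
  IsSchurMultiplier D Φ ∧ Φ.comp Φ = Φ

/-- A subspace `X ⊆ B H` is a `D`-bimodule if `D X D ⊆ X`. -/
def IsBimodule (D : StarSubalgebra ℂ (B H)) (X : Submodule ℂ (B H)) : Prop :=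
  ∀ A ∈ D, ∀ C ∈ D, ∀ T ∈ X, A * T * C ∈ X

/-- The Arveson distance `α(T, X)`. -/
def arveson (T : B H) (X : Set (B H)) : ℝ :=
  ⨆ ξ : {ξ : H // ‖ξ‖ = 1}, ⨅ S : X, ‖T ξ.1 - S.1 ξ.1‖

/-- The set of hyperreflexivity constants of `X`. -/
def hyperSet (X : Set (B H)) : Set ℝ :=
  {k | 0 < k ∧ ∀ T : B H, Metric.infDist T X ≤ k * arveson T X}

/-- A subspace is hyperreflexive if `d(T, X) ≤ k ⬝ α(T, X)` for some `k > 0`. -/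
def Hyperreflexive (X : Set (B H)) : Prop := (hyperSet X).Nonempty

/-- The hyperreflexivity constant `k(X)`: the least constant that works. -/
def hyperConst (X : Set (B H)) : ℝ := sInf (hyperSet X)

/-- The set of constants `λ` witnessing that a Schur idempotent lies in `𝔉H`. -/
def lamSet (Φ : B H →L[ℂ] B H) : Set ℝ :=
  {l | 0 < l ∧ ∀ T : B H, ‖T - Φ T‖ ≤ l * arveson T (Set.range Φ)}

/-- The class `𝔉H` of Schur idempotents `Φ` such that
`‖T - Φ T‖ ≤ λ ⬝ α(T, ran Φ)` for some `λ > 0` and all `T`. -/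
def MemFH (D : StarSubalgebra ℂ (B H)) (Φ : B H →L[ℂ] B H) : Prop :=
  IsSchurIdempotent D Φ ∧ (lamSet Φ).Nonempty

/-- The constant `λ(Φ)`: the least constant witnessing membership of `𝔉H`. -/
def lam (Φ : B H →L[ℂ] B H) : ℝ := sInf (lamSet Φ)

/-- A ternary masa-bimodule condition: `S T* R ∈ M` whenever `S, T, R ∈ M`. -/
def IsTernary (M : Submodule ℂ (B H)) : Prop :=
  ∀ S ∈ M, ∀ T ∈ M, ∀ R ∈ M, S * star T * R ∈ M

end SchurHyper

namespace SchurHyper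

section Arveson

variable {H : Type*} [NormedAddCommGroup H] [InnerProductSpace ℂ H]

lemma bddBelow_norm_sub_apply (T : B H) (X : Set (B H)) (ξ : H) :
    BddBelow (Set.range fun S : X => ‖T ξ - S.1 ξ‖) :=
  ⟨0, by rintro _ ⟨S, rfl⟩; exact norm_nonneg _⟩

lemma bddAbove_arveson (T : B H) {X : Set (B H)} (hX : (0 : B H) ∈ X) :
    BddAbove (Set.range fun ξ : {ξ : H // ‖ξ‖ = 1} => ⨅ S : X, ‖T ξ.1 - S.1 ξ.1‖) := by
  refine ⟨‖T‖, ?_⟩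
  rintro _ ⟨ξ, rfl⟩
  refine (ciInf_le (bddBelow_norm_sub_apply T X ξ.1) ⟨0, hX⟩).trans ?_
  simpa [ξ.2] using T.le_opNorm ξ.1

lemma arveson_nonneg (T : B H) (X : Set (B H)) : 0 ≤ arveson T X :=
  Real.iSup_nonneg fun _ => Real.iInf_nonneg fun _ => norm_nonneg _

/-- Any vector witnesses the Arveson distance up to `ε`. -/
lemma exists_norm_sub_apply_lt (T : B H) {X : Set (B H)} (hX : (0 : B H) ∈ X) (ξ : H)
    {ε : ℝ} (hε : 0 < ε) : ∃ S ∈ X, ‖T ξ - S ξ‖ < arveson T X * ‖ξ‖ + ε := by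
  by_cases hξ : ξ = 0
  · exact ⟨0, hX, by simpa [hξ] using hε⟩
  have hn : 0 < ‖ξ‖ := norm_pos_iff.2 hξ
  set η : H := ((‖ξ‖⁻¹ : ℝ) : ℂ) • ξ with hη
  have hη1 : ‖η‖ = 1 := by simp [hη, norm_smul, hn.ne']
  have hle : (⨅ S : X, ‖T η - S.1 η‖) ≤ arveson T X :=
    le_ciSup (bddAbove_arveson T hX) ⟨η, hη1⟩
  have : Nonempty X := ⟨⟨0, hX⟩⟩
  obtain ⟨S, hS⟩ := exists_lt_of_ciInf_lt
    (hle.trans_lt (lt_add_of_pos_right (arveson T X) (div_pos hε hn)))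
  refine ⟨S.1, S.2, ?_⟩
  have hξη : ξ = ((‖ξ‖ : ℝ) : ℂ) • η := by
    rw [hη, smul_smul, ← Complex.ofReal_mul, mul_inv_cancel₀ hn.ne']; simp
  have h2 : ‖T ξ - S.1 ξ‖ = ‖ξ‖ * ‖T η - S.1 η‖ := by
    calc ‖T ξ - S.1 ξ‖ = ‖(T - S.1) (((‖ξ‖ : ℝ) : ℂ) • η)‖ := by rw [← hξη]; rfl
      _ = ‖ξ‖ * ‖T η - S.1 η‖ := by rw [map_smul, norm_smul]; simp
  rw [h2]
  calc ‖ξ‖ * ‖T η - S.1 η‖ < ‖ξ‖ * (arveson T X + ε / ‖ξ‖) := by gcongr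
    _ = arveson T X * ‖ξ‖ + ε := by field_simp

lemma arveson_anti (T : B H) {X Y : Set (B H)} (hX : (0 : B H) ∈ X) (hXY : X ⊆ Y) :
    arveson T Y ≤ arveson T X := by
  have : Nonempty X := ⟨⟨0, hX⟩⟩
  refine ciSup_mono (bddAbove_arveson T hX) fun ξ => ?_
  exact le_ciInf fun S => ciInf_le (bddBelow_norm_sub_apply T Y ξ.1) ⟨S.1, hXY S.2⟩

lemma arveson_le {T : B H} {X : Set (B H)} {c : ℝ} (hc : 0 ≤ c)
    (h : ∀ ξ : H, ‖ξ‖ = 1 → ∀ ε > 0, ∃ S ∈ X, ‖T ξ - S ξ‖ ≤ c + ε) : arveson T X ≤ c := by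
  refine Real.iSup_le (fun ξ => le_of_forall_pos_le_add fun ε hε => ?_) hc
  obtain ⟨S, hS, hle⟩ := h ξ.1 ξ.2 ε hε
  exact (ciInf_le (bddBelow_norm_sub_apply T X ξ.1) ⟨S, hS⟩).trans hle

end Arveson

section Masa

variable {H : Type*} [NormedAddCommGroup H] [InnerProductSpace ℂ H]

lemma apply_mem_topologicalClosure {K : Submodule ℂ H} {A : B H} (hK : ∀ x ∈ K, A x ∈ K) :
    ∀ x ∈ K.topologicalClosure, A x ∈ K.topologicalClosure := fun _ hx =>
  map_mem_closure A.continuous hx hK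

/-- The subspace `X ξ` of `H`. -/
def orbit (X : Submodule ℂ (B H)) (ξ : H) : Submodule ℂ H :=
  X.map (ContinuousLinearMap.apply ℂ H ξ).toLinearMap

lemma mem_orbit {X : Submodule ℂ (B H)} {ξ x : H} : x ∈ orbit X ξ ↔ ∃ S ∈ X, S ξ = x :=
  Iff.rfl

variable [CompleteSpace H] {D : StarSubalgebra ℂ (B H)}

/-- The projection onto a closed subspace invariant under a masa belongs to the masa. -/
lemma IsMasa.starProjection_mem (hD : IsMasa D) (K : Submodule ℂ H) [K.HasOrthogonalProjection]
    (hK : ∀ A ∈ D, ∀ x ∈ K, A x ∈ K) : K.starProjection ∈ D := by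
  refine hD.2 _ fun A hA => ?_
  ext x
  have hperp : A (x - K.starProjection x) ∈ Kᗮ := by
    intro y hy
    rw [← ContinuousLinearMap.adjoint_inner_left]
    exact K.sub_starProjection_mem_orthogonal x _ (hK _ (star_mem hA) y hy)
  change K.starProjection (A x) = A (K.starProjection x)
  refine Submodule.eq_starProjection_of_mem_of_inner_eq_zero
    (hK A hA _ (K.starProjection_apply_mem x)) fun w hw => ?_
  rw [← map_sub]
  exact Submodule.inner_left_of_mem_orthogonal hw hperp

/-- The Arveson distance to a masa-bimodule is controlled by compressions to projections of the
masa which annihilate the bimodule. -/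
lemma arveson_le_of_compression (hD : IsMasa D) {X : Submodule ℂ (B H)} (hX : IsBimodule D X)
    {T : B H} {c : ℝ} (hc : 0 ≤ c)
    (h : ∀ P ∈ D, ∀ Q ∈ D, ‖P‖ ≤ 1 → ‖Q‖ ≤ 1 → (∀ S ∈ X, Q * S * P = 0) → ‖Q * T * P‖ ≤ c) :
    arveson T (X : Set (B H)) ≤ c := by
  refine arveson_le hc fun ξ hξ ε hε => ?_
  set K := (orbit X ξ).topologicalClosure
  set L := (orbit (Subalgebra.toSubmodule D.toSubalgebra) ξ).topologicalClosure
  have : CompleteSpace K := (orbit X ξ).isClosed_topologicalClosure.completeSpace_coe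
  have : CompleteSpace L := (orbit (Subalgebra.toSubmodule D.toSubalgebra) ξ
    ).isClosed_topologicalClosure.completeSpace_coe
  have hK : K.starProjection ∈ D := hD.starProjection_mem K fun A hA =>
    apply_mem_topologicalClosure fun x hx => by
      obtain ⟨S, hS, rfl⟩ := mem_orbit.1 hx
      exact mem_orbit.2 ⟨A * S, by simpa using hX A hA 1 (one_mem D) S hS, rfl⟩
  have hP : L.starProjection ∈ D := hD.starProjection_mem L fun A hA =>
    apply_mem_topologicalClosure fun x hx => by
      obtain ⟨S, hS, rfl⟩ := mem_orbit.1 hx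
      exact mem_orbit.2 ⟨A * S, mul_mem (S := StarSubalgebra ℂ (B H)) hA hS, rfl⟩
  have hQeq : Kᗮ.starProjection = 1 - K.starProjection := K.starProjection_orthogonal'
  have hQ : Kᗮ.starProjection ∈ D := hQeq ▸ sub_mem (one_mem D) hK
  have hQapply : ∀ x, Kᗮ.starProjection x = x - K.starProjection x := fun x => by
    rw [hQeq]; rfl
  have hξL : L.starProjection ξ = ξ := Submodule.starProjection_eq_self_iff.2
    (Submodule.le_topologicalClosure _ (mem_orbit.2 ⟨1, one_mem D, rfl⟩))
  have hann : ∀ S ∈ X, Kᗮ.starProjection * S * L.starProjection = 0 := by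
    intro S hS
    have hSL : ∀ x ∈ L, S x ∈ K := fun x hx => map_mem_closure S.continuous hx fun y hy => by
      obtain ⟨A, hA, rfl⟩ := mem_orbit.1 hy
      exact mem_orbit.2 ⟨S * A, by simpa using hX 1 (one_mem D) A hA S hS, rfl⟩
    ext x
    change Kᗮ.starProjection (S (L.starProjection x)) = 0
    rw [hQapply, Submodule.starProjection_eq_self_iff.2 (hSL _ (L.starProjection_apply_mem x)),
      sub_self]
  have hle := h _ hP _ hQ L.starProjection_norm_le Kᗮ.starProjection_norm_le hann
  have hTξ : ‖T ξ - K.starProjection (T ξ)‖ ≤ c := by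
    rw [← hQapply]
    have := (Kᗮ.starProjection * T * L.starProjection).le_opNorm ξ
    rw [hξ, mul_one] at this
    simpa [hξL] using this.trans hle
  obtain ⟨y, hy, hdist⟩ := Metric.mem_closure_iff.1 (K.starProjection_apply_mem (T ξ)) ε hε
  obtain ⟨S, hS, rfl⟩ := mem_orbit.1 hy
  refine ⟨S, hS, ?_⟩
  rw [dist_eq_norm] at hdist
  calc ‖T ξ - S ξ‖
      = ‖(T ξ - K.starProjection (T ξ)) + (K.starProjection (T ξ) - S ξ)‖ := by
        rw [sub_add_sub_cancel]
    _ ≤ c + ε := norm_add_le_of_le hTξ hdist.le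

end Masa

section Multipliers

variable {H : Type*} [NormedAddCommGroup H] [InnerProductSpace ℂ H]

lemma zero_mem_range (Φ : B H →L[ℂ] B H) : (0 : B H) ∈ Set.range Φ := ⟨0, map_zero Φ⟩

lemma bddBelow_lamSet (Φ : B H →L[ℂ] B H) : BddBelow (lamSet Φ) := ⟨0, fun _ h => h.1.le⟩

lemma wStarContinuous_iff {Φ : B H →L[ℂ] B H} : WStarContinuous H Φ ↔
    ∀ ω : {ω : B H →ₗ[ℂ] ℂ // IsNormalFunctional H ω},
      @Continuous _ _ (weakStarTopology H) _ fun T => ω.1 (Φ T) := by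
  let := weakStarTopology H
  exact continuous_induced_rng.trans continuous_pi_iff

lemma WStarContinuous.comp {Φ Ψ : B H →L[ℂ] B H} (hΦ : WStarContinuous H Φ)
    (hΨ : WStarContinuous H Ψ) : WStarContinuous H (Φ.comp Ψ) :=
  @Continuous.comp _ _ _ (weakStarTopology H) (weakStarTopology H) (weakStarTopology H) Ψ Φ
    hΦ hΨ

lemma WStarContinuous.add {Φ Ψ : B H →L[ℂ] B H} (hΦ : WStarContinuous H Φ)
    (hΨ : WStarContinuous H Ψ) : WStarContinuous H (Φ + Ψ) := by
  rw [wStarContinuous_iff] at *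
  intro ω
  let := weakStarTopology H
  simpa [Pi.add_def] using (hΦ ω).add (hΨ ω)

lemma WStarContinuous.sub {Φ Ψ : B H →L[ℂ] B H} (hΦ : WStarContinuous H Φ)
    (hΨ : WStarContinuous H Ψ) : WStarContinuous H (Φ - Ψ) := by
  rw [wStarContinuous_iff] at *
  intro ω
  let := weakStarTopology H
  simpa [Pi.sub_def] using (hΦ ω).sub (hΨ ω)

variable [CompleteSpace H] {D : StarSubalgebra ℂ (B H)} {Φ Ψ : B H →L[ℂ] B H}

lemma IsSchurMultiplier.comp (hΦ : IsSchurMultiplier D Φ) (hΨ : IsSchurMultiplier D Ψ) :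
    IsSchurMultiplier D (Φ.comp Ψ) :=
  ⟨hΦ.1.comp hΨ.1, fun A hA C hC T => by
    simp only [ContinuousLinearMap.comp_apply, hΨ.2 A hA C hC, hΦ.2 A hA C hC]⟩

lemma IsSchurMultiplier.add (hΦ : IsSchurMultiplier D Φ) (hΨ : IsSchurMultiplier D Ψ) :
    IsSchurMultiplier D (Φ + Ψ) :=
  ⟨hΦ.1.add hΨ.1, fun A hA C hC T => by
    simp only [add_apply, hΨ.2 A hA C hC, hΦ.2 A hA C hC, mul_add, add_mul]⟩

lemma IsSchurMultiplier.sub (hΦ : IsSchurMultiplier D Φ) (hΨ : IsSchurMultiplier D Ψ) :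
    IsSchurMultiplier D (Φ - Ψ) :=
  ⟨hΦ.1.sub hΨ.1, fun A hA C hC T => by
    simp only [sub_apply, hΨ.2 A hA C hC, hΦ.2 A hA C hC, mul_sub, sub_mul]⟩

lemma IsSchurMultiplier.isBimodule_range (hΦ : IsSchurMultiplier D Φ) :
    IsBimodule D (LinearMap.range Φ.toLinearMap) := by
  rintro A hA C hC _ ⟨T, rfl⟩
  exact ⟨A * T * C, hΦ.2 A hA C hC T⟩

lemma IsSchurMultiplier.arveson_range_le (hΦ : IsSchurMultiplier D Φ) (hD : IsMasa D)
    {T : B H} {c : ℝ} (hc : 0 ≤ c)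
    (h : ∀ P ∈ D, ∀ Q ∈ D, ‖P‖ ≤ 1 → ‖Q‖ ≤ 1 → (∀ S, Q * Φ S * P = 0) → ‖Q * T * P‖ ≤ c) :
    arveson T (Set.range Φ) ≤ c := by
  exact arveson_le_of_compression hD hΦ.isBimodule_range (T := T) hc
    fun P hP Q hQ hP1 hQ1 hann => h P hP Q hQ hP1 hQ1 fun S => hann _ ⟨S, rfl⟩

/-- A Schur multiplier leaves the range of any member of `𝔉H` invariant. -/
lemma MemFH.apply_apply_apply (hΦ : MemFH D Φ) (hD : IsMasa D) (hΨ : IsSchurMultiplier D Ψ)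
    (T : B H) : Φ (Ψ (Φ T)) = Ψ (Φ T) := by
  obtain ⟨⟨hΦm, -⟩, l, hl, hlam⟩ := hΦ
  have hα : arveson (Ψ (Φ T)) (Set.range Φ) ≤ 0 :=
    hΦm.arveson_range_le hD le_rfl fun P hP Q hQ _ _ hann => by
      rw [← hΨ.2 Q hQ P hP, hann, map_zero, norm_zero]
  have := (hlam (Ψ (Φ T))).trans (mul_nonpos_of_nonneg_of_nonpos hl.le hα)
  exact (sub_eq_zero.1 (norm_le_zero_iff.1 this)).symm

/-- Subtracting a `𝔉H`-projection trades the Arveson distance to `ran Φ` for the distance to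
`ran Φ + ran Ψ`. -/
lemma arveson_sub_apply_le (hD : IsMasa D) (hΦ : IsSchurMultiplier D Φ)
    (hΨ : IsSchurMultiplier D Ψ) {l : ℝ} (hl : l ∈ lamSet Ψ) (T : B H) :
    arveson (T - Ψ T) (Set.range Φ) ≤ l * arveson T (Set.range Φ + Set.range Ψ) := by
  have hα := arveson_nonneg T (Set.range Φ + Set.range Ψ)
  have h0 : (0 : B H) ∈ Set.range Φ + Set.range Ψ :=
    ⟨0, zero_mem_range Φ, 0, zero_mem_range Ψ, add_zero 0⟩
  refine hΦ.arveson_range_le hD (mul_nonneg hl.1.le hα) fun P hP Q hQ hP1 hQ1 hann => ?_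
  have heq : Q * (T - Ψ T) * P = Q * T * P - Ψ (Q * T * P) := by
    rw [hΨ.2 Q hQ P hP, mul_sub, sub_mul]
  rw [heq]
  refine (hl.2 _).trans (mul_le_mul_of_nonneg_left ?_ hl.1.le)
  refine arveson_le hα fun ξ hξ ε hε => ?_
  obtain ⟨_, ⟨_, ⟨S, rfl⟩, _, ⟨R, rfl⟩, rfl⟩, hlt⟩ := exists_norm_sub_apply_lt T h0 (P ξ) hε
  refine ⟨Q * Ψ R * P, ⟨Q * R * P, hΨ.2 Q hQ P hP R⟩, ?_⟩
  have hS : Q (Φ S (P ξ)) = 0 := by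
    have := congrArg (fun A : B H => A ξ) (hann S)
    simpa using this
  have hPξ : ‖P ξ‖ ≤ 1 := by simpa [hξ] using P.le_of_opNorm_le hP1 ξ
  calc ‖(Q * T * P) ξ - (Q * Ψ R * P) ξ‖ = ‖Q (T (P ξ) - (Φ S + Ψ R) (P ξ))‖ := by
        simp [hS]
    _ ≤ ‖T (P ξ) - (Φ S + Ψ R) (P ξ)‖ := by
        simpa only [one_mul] using Q.le_of_opNorm_le hQ1 (T (P ξ) - (Φ S + Ψ R) (P ξ))
    _ ≤ arveson T (Set.range Φ + Set.range Ψ) * ‖P ξ‖ + ε := hlt.le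
    _ ≤ arveson T (Set.range Φ + Set.range Ψ) + ε := by
        gcongr
        exact mul_le_of_le_one_right hα hPξ

lemma MemFH.range_sup (hΦ : MemFH D Φ) (hΨ : MemFH D Ψ) (hD : IsMasa D) :
    Set.range ⇑(Φ + Ψ - Φ.comp Ψ) = Set.range Φ + Set.range Ψ := by
  have hΨi : ∀ T, Ψ (Ψ T) = Ψ T := fun T => congrArg (fun F : B H →L[ℂ] B H => F T) hΨ.1.2
  have hΦi : ∀ T, Φ (Φ T) = Φ T := fun T => congrArg (fun F : B H →L[ℂ] B H => F T) hΦ.1.2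
  ext R
  constructor
  · rintro ⟨T, rfl⟩
    exact ⟨Φ (T - Ψ T), ⟨_, rfl⟩, Ψ T, ⟨_, rfl⟩, by simp; abel⟩
  · rintro ⟨_, ⟨S, rfl⟩, _, ⟨T, rfl⟩, rfl⟩
    exact ⟨Φ S + Ψ T, by simp [hΨi, hΦi, hΦ.apply_apply_apply hD hΨ.1.1]; abel⟩

lemma MemFH.isSchurIdempotent_sup (hΦ : MemFH D Φ) (hΨ : MemFH D Ψ) (hD : IsMasa D) :
    IsSchurIdempotent D (Φ + Ψ - Φ.comp Ψ) := by
  have hΨi : ∀ T, Ψ (Ψ T) = Ψ T := fun T => congrArg (fun F : B H →L[ℂ] B H => F T) hΨ.1.2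
  have hΦi : ∀ T, Φ (Φ T) = Φ T := fun T => congrArg (fun F : B H →L[ℂ] B H => F T) hΦ.1.2
  refine ⟨(hΦ.1.1.add hΨ.1.1).sub (hΦ.1.1.comp hΨ.1.1), ContinuousLinearMap.ext fun T => ?_⟩
  simp [hΨi, hΦi, hΦ.apply_apply_apply hD hΨ.1.1]

lemma mul_mem_lamSet_sup (hΦ : MemFH D Φ) (hΨ : MemFH D Ψ) (hD : IsMasa D) {l m : ℝ}
    (hl : l ∈ lamSet Φ) (hm : m ∈ lamSet Ψ) : l * m ∈ lamSet (Φ + Ψ - Φ.comp Ψ) := by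
  refine ⟨mul_pos hl.1 hm.1, fun T => ?_⟩
  rw [hΦ.range_sup hΨ hD, mul_assoc]
  have heq : T - (Φ + Ψ - Φ.comp Ψ) T = (T - Ψ T) - Φ (T - Ψ T) := by
    simp; abel
  rw [heq]
  exact (hl.2 _).trans
    (mul_le_mul_of_nonneg_left (arveson_sub_apply_le hD hΦ.1.1 hΨ.1.1 hm T) hl.1.le)

lemma MemFH.sup (hΦ : MemFH D Φ) (hΨ : MemFH D Ψ) (hD : IsMasa D) :
    MemFH D (Φ + Ψ - Φ.comp Ψ) := by
  obtain ⟨l, hl⟩ := hΦ.2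
  obtain ⟨m, hm⟩ := hΨ.2
  exact ⟨hΦ.isSchurIdempotent_sup hΨ hD, l * m, mul_mem_lamSet_sup hΦ hΨ hD hl hm⟩

lemma MemFH.lam_sup_le (hΦ : MemFH D Φ) (hΨ : MemFH D Ψ) (hD : IsMasa D) :
    lam (Φ + Ψ - Φ.comp Ψ) ≤ lam Φ * lam Ψ := by
  have hcont : Filter.Tendsto (fun ε : ℝ => (lam Φ + ε) * (lam Ψ + ε)) (nhdsWithin 0 (Set.Ioi 0))
      (nhds (lam Φ * lam Ψ)) := by
    have : Continuous fun ε : ℝ => (lam Φ + ε) * (lam Ψ + ε) := by fun_prop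
    simpa using (this.tendsto 0).mono_left nhdsWithin_le_nhds
  refine ge_of_tendsto hcont (eventually_mem_nhdsWithin.mono fun ε (hε : 0 < ε) => ?_)
  obtain ⟨l, hl, hlε⟩ := exists_lt_of_csInf_lt hΦ.2 (lt_add_of_pos_right (lam Φ) hε)
  obtain ⟨m, hm, hmε⟩ := exists_lt_of_csInf_lt hΨ.2 (lt_add_of_pos_right (lam Ψ) hε)
  exact (csInf_le (bddBelow_lamSet _) (mul_mem_lamSet_sup hΦ hΨ hD hl hm)).trans
    (mul_le_mul hlε.le hmε.le hm.1.le (hl.1.trans hlε).le)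

lemma MemFH.inf (hΦ : MemFH D Φ) (hΨ : MemFH D Ψ) (hD : IsMasa D) : MemFH D (Φ.comp Ψ) := by
  have hΨΦΨ := hΨ.apply_apply_apply hD hΦ.1.1
  have hΦi : ∀ T, Φ (Φ T) = Φ T := fun T => congrArg (fun F : B H →L[ℂ] B H => F T) hΦ.1.2
  obtain ⟨l, hl⟩ := hΦ.2
  obtain ⟨m, hm⟩ := hΨ.2
  refine ⟨⟨hΦ.1.1.comp hΨ.1.1, ContinuousLinearMap.ext fun T => ?_⟩, l + ‖Φ‖ * m,
    add_pos_of_pos_of_nonneg hl.1 (mul_nonneg (norm_nonneg _) hm.1.le), fun T => ?_⟩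
  · simp [hΨΦΨ, hΦi]
  have hαΦ : arveson T (Set.range Φ) ≤ arveson T (Set.range (Φ.comp Ψ)) :=
    arveson_anti T (zero_mem_range _) (by rintro _ ⟨S, rfl⟩; exact ⟨Ψ S, rfl⟩)
  have hαΨ : arveson T (Set.range Ψ) ≤ arveson T (Set.range (Φ.comp Ψ)) :=
    arveson_anti T (zero_mem_range _) (by rintro _ ⟨S, rfl⟩; exact ⟨Φ (Ψ S), hΨΦΨ S⟩)
  calc ‖T - Φ.comp Ψ T‖ = ‖(T - Φ T) + Φ (T - Ψ T)‖ := by simp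
    _ ≤ l * arveson T (Set.range (Φ.comp Ψ)) + ‖Φ‖ * (m * arveson T (Set.range (Φ.comp Ψ))) :=
        norm_add_le_of_le ((hl.2 T).trans (mul_le_mul_of_nonneg_left hαΦ hl.1.le))
          (Φ.le_opNorm_of_le ((hm.2 T).trans (mul_le_mul_of_nonneg_left hαΨ hm.1.le)))
    _ = (l + ‖Φ‖ * m) * arveson T (Set.range (Φ.comp Ψ)) := by ring

end Multipliers

end SchurHyper

open SchurHyper

/-- if `Φ₁, Φ₂ ∈ 𝔉H`, then the Schur idempotent
`Φ₁∨Φ₂ = Φ₁ + Φ₂ − Φ₁∘Φ₂` (whose range is `ran Φ₁ + ran Φ₂`) belongs to `𝔉H`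
with `λ(Φ₁∨Φ₂) ≤ λ(Φ₁)·λ(Φ₂)`; together with closure under the meet `Φ₁∘Φ₂`,
the set `𝔉H` is a sublattice of the lattice of Schur idempotents. -/
theorem stmt5 {H : Type*} [NormedAddCommGroup H] [InnerProductSpace ℂ H] [CompleteSpace H]
    [TopologicalSpace.SeparableSpace H]
    (D : StarSubalgebra ℂ (B H)) (hD : IsMasa D)
    (Φ₁ Φ₂ : B H →L[ℂ] B H) (h₁ : MemFH D Φ₁) (h₂ : MemFH D Φ₂) :
    Set.range ⇑(Φ₁ + Φ₂ - Φ₁.comp Φ₂) = Set.range ⇑Φ₁ + Set.range ⇑Φ₂ ∧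
    MemFH D (Φ₁ + Φ₂ - Φ₁.comp Φ₂) ∧
    lam (Φ₁ + Φ₂ - Φ₁.comp Φ₂) ≤ lam Φ₁ * lam Φ₂ ∧
    MemFH D (Φ₁.comp Φ₂) := by
  exact ⟨h₁.range_sup h₂ hD, h₁.sup h₂ hD, h₁.lam_sup_le h₂ hD, h₁.inf h₂ hD⟩
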